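/- Suppose the Jacobi parameters satisfy Σ_{n=1}^∞ (|a_n − 1| + |b_n|) < ∞. Then for every ε ∈ (0, 2) there is uniform clock behavior on [−2+ε, 2−ε]: sup{ | n(E′ − E) − π·√(4 − E²) | : E < E′ successive zeros of p_n with E, E′ ∈ [−2+ε, 2−ε] } → 0 as n → ∞. (Here π√(4 − E²) is the reciprocal of the density of states dν/dE = (π√(4 − E²))^{−1}.) -/

import Mathlib

open scoped BigOperators

/-- The orthonormal polynomials for Jacobi parameters `a`, `b`:
`orthoP a b n` is `p_{n-1}`, so that `orthoP a b 0 = p₋₁ = 0`, `orthoP a b 1 = p₀ = 1`,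
and `a (n+1) * p (n+1) = (x - b (n+1)) * p n - a n * p (n-1)`. -/
noncomputable def orthoPAux (a b : ℕ → ℝ) : ℕ → ℝ → ℝ
  | 0 => fun _ => 0
  | 1 => fun _ => 1
  | (n+2) => fun x =>
      ((x - b (n+1)) * orthoPAux a b (n+1) x - a n * orthoPAux a b n x) / a (n+1)

/-- The orthonormal polynomial `p n` evaluated at `x`. -/
noncomputable def orthoP (a b : ℕ → ℝ) (n : ℕ) (x : ℝ) : ℝ := orthoPAux a b (n+1) x

open Real in
lemma cj_key (G : ℝ → ℂ) (m : ℕ) (t u κ : ℝ)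
    (h0 : (Complex.exp ((m * t : ℝ) * Complex.I) * G t).im = 0)
    (hκ : ‖G u - G t‖ ≤ κ) :
    ∃ r : ℝ, |r| = ‖G t‖ ∧ Complex.exp ((m * t : ℝ) * Complex.I) * G t = r ∧
      |(Complex.exp ((m * u : ℝ) * Complex.I) * G u).im - r * Real.sin (m * (u - t))| ≤ κ := by
  set w := Complex.exp ((m * t : ℝ) * Complex.I) * G t with hw
  have hwr : w = (w.re : ℂ) := by
    apply Complex.ext <;> simp [h0]
  refine ⟨w.re, ?_, hwr, ?_⟩
  · have : ‖w‖ = ‖G t‖ := by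
      rw [hw, norm_mul, Complex.norm_exp_ofReal_mul_I, one_mul]
    rw [← this, hwr]; simp
  · have e1 : Complex.exp ((m * u : ℝ) * Complex.I) * G u
        = Complex.exp ((m * u : ℝ) * Complex.I) * (G u - G t)
          + Complex.exp ((m * (u - t) : ℝ) * Complex.I) * w := by
      have : Complex.exp ((m * u : ℝ) * Complex.I)
          = Complex.exp ((m * (u - t) : ℝ) * Complex.I) * Complex.exp ((m * t : ℝ) * Complex.I) := by
        rw [← Complex.exp_add]; congr 1; push_cast; ring
      rw [hw, mul_sub, ← mul_assoc, ← this]; ring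
    have e2 : (Complex.exp ((m * (u - t) : ℝ) * Complex.I) * w).im
        = w.re * Real.sin (m * (u - t)) := by
      rw [hwr, Complex.im_mul_ofReal, Complex.exp_ofReal_mul_I_im]; simp [mul_comm]
    rw [e1, Complex.add_im, e2, add_sub_cancel_right]
    refine (Complex.abs_im_le_norm _).trans ?_
    rw [norm_mul, Complex.norm_exp_ofReal_mul_I, one_mul]; exact hκ

/-- upper bound on the gap -/
lemma cj_upper (G : ℝ → ℂ) (hG : Continuous G) (m : ℕ) (hm : 0 < m) (t u κ c η : ℝ)
    (hη : 0 < η) (hη1 : η ≤ 1)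
    (hc : c ≤ ‖G t‖) (hκ0 : κ < c * Real.sin (η / 2))
    (h0 : (Complex.exp ((m * t : ℝ) * Complex.I) * G t).im = 0)
    (hκ : ∀ v ∈ Set.Icc t (t + (Real.pi + η) / m), v ≤ u → ‖G v - G t‖ ≤ κ)
    (hno : ∀ v ∈ Set.Ioo t u, (Complex.exp ((m * v : ℝ) * Complex.I) * G v).im ≠ 0) :
    m * (u - t) < Real.pi + η := by
  by_contra hcon
  push Not at hcon
  have hmR : (0:ℝ) < m := by exact_mod_cast hm
  have hpi := Real.pi_gt_three
  have hs : 0 < Real.sin (η / 2) := Real.sin_pos_of_pos_of_lt_pi (by linarith) (by linarith)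
  have hu : t + (Real.pi + η) / m ≤ u := by
    have : (Real.pi + η) / m ≤ u - t := by rw [div_le_iff₀ hmR]; linarith
    linarith
  set v1 := t + (η / 2) / m with hv1
  set v2 := t + (Real.pi + η / 2) / m with hv2
  have a1 : t < v1 := by rw [hv1]; have : 0 < (η/2)/m := by positivity
                         linarith
  have a2 : v1 < v2 := by
    rw [hv1, hv2]; gcongr; linarith
  have a3 : v2 < t + (Real.pi + η) / m := by rw [hv2]; gcongr; linarith
  obtain ⟨r, hr, hr', k1⟩ := cj_key G m t v1 κ h0 (hκ v1 ⟨by linarith, by linarith⟩ (by linarith))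
  obtain ⟨r2, hr2, hr2', k2⟩ := cj_key G m t v2 κ h0 (hκ v2 ⟨by linarith, by linarith⟩ (by linarith))
  have hrr : r2 = r := by
    have := hr2'.symm.trans hr'; exact_mod_cast this
  subst hrr
  have e1 : (m:ℝ) * (v1 - t) = η / 2 := by rw [hv1]; field_simp; ring
  have e2 : (m:ℝ) * (v2 - t) = η / 2 + Real.pi := by rw [hv2]; field_simp; ring
  rw [e1] at k1
  rw [e2, Real.sin_add_pi] at k2
  have hlow : κ < |r2| * Real.sin (η / 2) := by
    refine hκ0.trans_le ?_
    rw [hr]; gcongr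
  set F : ℝ → ℝ := fun v => (Complex.exp ((m * v : ℝ) * Complex.I) * G v).im with hF
  have hFc : Continuous F := by rw [hF]; fun_prop
  have hz : (0:ℝ) ∈ Set.uIcc (F v1) (F v2) := by
    rw [abs_le] at k1 k2
    rw [Set.mem_uIcc]
    rcases le_total 0 r2 with h | h
    · rw [abs_of_nonneg h] at hlow
      right; constructor <;> simp only [hF] <;> nlinarith
    · rw [abs_of_nonpos h] at hlow
      left; constructor <;> simp only [hF] <;> nlinarith
  obtain ⟨v, hv, hv0⟩ := intermediate_value_uIcc hFc.continuousOn hz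
  rw [Set.uIcc_of_le a2.le] at hv
  exact hno v ⟨by linarith [hv.1], by linarith [hv.2]⟩ hv0

/-- dichotomy: the gap is tiny or at least about pi -/
lemma cj_dich (G : ℝ → ℂ) (m : ℕ) (t u κ c η : ℝ)
    (hη : 0 < η) (hη1 : η ≤ 1)
    (hc : c ≤ ‖G t‖) (hκ0 : κ < c * Real.sin η)
    (h0 : (Complex.exp ((m * t : ℝ) * Complex.I) * G t).im = 0)
    (h1 : (Complex.exp ((m * u : ℝ) * Complex.I) * G u).im = 0)
    (hκ : ‖G u - G t‖ ≤ κ) :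
    m * (u - t) < η ∨ Real.pi - η < m * (u - t) := by
  by_contra hcon
  push Not at hcon
  obtain ⟨h2, h3⟩ := hcon
  obtain ⟨r, hr, hr', k1⟩ := cj_key G m t u κ h0 hκ
  have hpi := Real.pi_gt_three
  have hs : 0 < Real.sin η := Real.sin_pos_of_pos_of_lt_pi (by linarith) (by linarith)
  have hs2 : Real.sin η ≤ Real.sin (m * (u - t)) := by
    rcases le_total (m * (u - t)) (Real.pi / 2) with h | h
    · exact Real.sin_le_sin_of_le_of_le_pi_div_two (by linarith) h h2
    · rw [← Real.sin_pi_sub (m * (u - t))]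
      exact Real.sin_le_sin_of_le_of_le_pi_div_two (by linarith) (by linarith) (by linarith)
  rw [h1, zero_sub, abs_neg, abs_mul, hr, abs_of_pos (hs.trans_le hs2)] at k1
  have : c * Real.sin η ≤ ‖G t‖ * Real.sin (m * (u - t)) := by
    have := norm_nonneg (G t)
    gcongr
  linarith

lemma cj_exp_diff (x y : ℝ) :
    ‖Complex.exp ((x : ℝ) * Complex.I) - Complex.exp ((y : ℝ) * Complex.I)‖ ≤ |x - y| := by
  have : Complex.exp ((x : ℝ) * Complex.I) - Complex.exp ((y : ℝ) * Complex.I)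
      = Complex.exp ((y : ℝ) * Complex.I) * (Complex.exp (Complex.I * ((x - y : ℝ))) - 1) := by
    rw [mul_sub, ← Complex.exp_add]; push_cast; ring_nf
  rw [this, norm_mul, Complex.norm_exp_ofReal_mul_I, one_mul]
  simpa using Real.norm_exp_I_mul_ofReal_sub_one_le (x := x - y)

/-- difference of imaginary parts for small gaps -/
lemma cj_small (G : ℝ → ℂ) (k m : ℕ) (hk : k ≤ m) (t u κ C τ : ℝ) (htu : t ≤ u)
    (hC : ‖G t‖ ≤ C) (hτ : m * (u - t) ≤ τ) (hκ : ‖G u - G t‖ ≤ κ) :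
    |(Complex.exp ((k * u : ℝ) * Complex.I) * G u).im
      - (Complex.exp ((k * t : ℝ) * Complex.I) * G t).im| ≤ τ * C + κ := by
  rw [← Complex.sub_im]
  refine (Complex.abs_im_le_norm _).trans ?_
  have e : Complex.exp ((k * u : ℝ) * Complex.I) * G u - Complex.exp ((k * t : ℝ) * Complex.I) * G t
    = (Complex.exp ((k * u : ℝ) * Complex.I) - Complex.exp ((k * t : ℝ) * Complex.I)) * G t
      + Complex.exp ((k * u : ℝ) * Complex.I) * (G u - G t) := by ring
  rw [e]
  refine (norm_add_le _ _).trans ?_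
  rw [norm_mul, norm_mul, Complex.norm_exp_ofReal_mul_I, one_mul]
  have h1 := cj_exp_diff (k * u) (k * t)
  have h2 : |(k:ℝ) * u - k * t| ≤ τ := by
    rw [← mul_sub, abs_of_nonneg (mul_nonneg (by positivity) (by linarith))]
    refine le_trans ?_ hτ
    have : (k:ℝ) ≤ m := by exact_mod_cast hk
    have : 0 ≤ u - t := by linarith
    gcongr
  have := norm_nonneg (G t)
  have : 0 ≤ τ := (abs_nonneg _).trans h2
  gcongr
  exact h1.trans h2

lemma cj_CD (a b : ℕ → ℝ) (ha : ∀ n, 0 < a n) (x y : ℝ) (n : ℕ) :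
    (x - y) * ∑ k ∈ Finset.range (n+1), orthoPAux a b k x * orthoPAux a b k y
      = a n * (orthoPAux a b (n+1) x * orthoPAux a b n y
        - orthoPAux a b n x * orthoPAux a b (n+1) y) := by
  induction n with
  | zero => simp [orthoPAux]
  | succ n ih =>
    rw [Finset.sum_range_succ, mul_add, ih]
    have := (ha (n+1)).ne'
    simp only [orthoPAux]
    field_simp
    ring

noncomputable def cjg (a b : ℕ → ℝ) (n : ℕ) (t : ℝ) : ℂ :=
  (a n * orthoPAux a b (n+1) (2 * Real.cos t) : ℝ)
    - Complex.exp (((-t : ℝ)) * Complex.I) * (orthoPAux a b n (2 * Real.cos t) : ℝ)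

noncomputable def cjG (a b : ℕ → ℝ) (n : ℕ) (t : ℝ) : ℂ :=
  Complex.exp ((-(n * t) : ℝ) * Complex.I) * cjg a b n t

lemma cj_cont (a b : ℕ → ℝ) (n : ℕ) : Continuous (orthoPAux a b n) ∧ Continuous (orthoPAux a b (n+1)) := by
  induction n with
  | zero => constructor <;> (simp only [orthoPAux]; fun_prop)
  | succ n ih =>
    refine ⟨ih.2, ?_⟩
    have h1 := ih.1
    have h2 := ih.2
    simp only [orthoPAux]
    fun_prop

lemma cjG_cont (a b : ℕ → ℝ) (n : ℕ) : Continuous (cjG a b n) := by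
  have h1 := (cj_cont a b n).1
  have h2 := (cj_cont a b n).2
  unfold cjG cjg
  fun_prop

lemma cjG_norm (a b : ℕ → ℝ) (n : ℕ) (t : ℝ) : ‖cjG a b n t‖ = ‖cjg a b n t‖ := by
  rw [cjG, norm_mul, Complex.norm_exp_ofReal_mul_I, one_mul]

lemma cjG_mul (a b : ℕ → ℝ) (n : ℕ) (t : ℝ) :
    Complex.exp ((n * t : ℝ) * Complex.I) * cjG a b n t = cjg a b n t := by
  rw [cjG, ← mul_assoc, ← Complex.exp_add]
  push_cast
  ring_nf; simp

lemma cjg_im (a b : ℕ → ℝ) (n : ℕ) (t : ℝ) :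
    (cjg a b n t).im = Real.sin t * orthoPAux a b n (2 * Real.cos t) := by
  rw [cjg, Complex.sub_im, Complex.im_mul_ofReal, Complex.exp_ofReal_mul_I_im]; simp

lemma cjg_zero (a b : ℕ → ℝ) (ha0 : a 0 = 1) (t : ℝ) : cjg a b 0 t = 1 := by
  simp [cjg, orthoPAux, ha0]

lemma cj_two_cos (t : ℝ) : ((2 * Real.cos t : ℝ) : ℂ) =
    Complex.exp ((t : ℝ) * Complex.I) + Complex.exp ((-t : ℝ) * Complex.I) := by
  apply Complex.ext
  · rw [Complex.add_re, Complex.exp_ofReal_mul_I_re, Complex.exp_ofReal_mul_I_re,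
      Complex.ofReal_re, Real.cos_neg]; ring
  · rw [Complex.add_im, Complex.exp_ofReal_mul_I_im, Complex.exp_ofReal_mul_I_im]; simp

lemma cjg_succ (a b : ℕ → ℝ) (ha : ∀ n, 0 < a n) (n : ℕ) (t : ℝ) :
    cjg a b (n+1) t = (Complex.exp ((t : ℝ) * Complex.I) - b (n+1)) * (orthoPAux a b (n+1) (2 * Real.cos t) : ℝ)
      - a n * (orthoPAux a b n (2 * Real.cos t) : ℝ) := by
  have h : a (n+1) * orthoPAux a b (n+1+1) (2 * Real.cos t) =
      (2 * Real.cos t - b (n+1)) * orthoPAux a b (n+1) (2 * Real.cos t)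
        - a n * orthoPAux a b n (2 * Real.cos t) := by
    have := (ha (n+1)).ne'
    rw [orthoPAux]; field_simp
  rw [cjg, h]
  have := cj_two_cos t
  push_cast at this ⊢
  rw [this]; ring

lemma cjg_step (a b : ℕ → ℝ) (ha : ∀ n, 0 < a n) (n : ℕ) (t : ℝ) :
    ‖cjg a b (n+1) t - Complex.exp ((t : ℝ) * Complex.I) * cjg a b n t‖ ≤
      (|a n - 1| + |b (n+1)|) * (|orthoPAux a b (n+1) (2 * Real.cos t)| + |orthoPAux a b n (2 * Real.cos t)|) := by
  set P := orthoPAux a b (n+1) (2 * Real.cos t)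
  set Q := orthoPAux a b n (2 * Real.cos t)
  have hz : Complex.exp ((t : ℝ) * Complex.I) * Complex.exp ((-t : ℝ) * Complex.I) = 1 := by
    rw [← Complex.exp_add]; simp
  have e : cjg a b (n+1) t - Complex.exp ((t : ℝ) * Complex.I) * cjg a b n t
      = Complex.exp ((t : ℝ) * Complex.I) * ((1 - a n : ℝ) * (P:ℝ)) - ((b (n+1) * P : ℝ)) + ((1 - a n) * Q : ℝ) := by
    rw [cjg_succ a b ha, cjg]
    push_cast at hz ⊢
    linear_combination (Q : ℂ) * hz
  rw [e]
  refine (norm_add_le _ _).trans ((add_le_add_left (norm_sub_le _ _) _).trans ?_)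
  rw [norm_mul, Complex.norm_exp_ofReal_mul_I, one_mul, ← Complex.ofReal_mul, Complex.norm_real,
    Complex.norm_real, Complex.norm_real]
  simp only [Real.norm_eq_abs, abs_mul]
  rw [abs_sub_comm 1 (a n)]
  have := mul_nonneg (abs_nonneg (b (n+1))) (abs_nonneg Q)
  nlinarith

/-- parameter bounds -/
lemma cj_bdd (a b : ℕ → ℝ) (ha : ∀ n, 0 < a n)
    (hsum : Summable (fun n : ℕ => |a (n+1) - 1| + |b (n+1)|)) :
    Summable (fun n : ℕ => |a n - 1| + |b (n+1)|) ∧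
    ∃ B : ℝ, 1 ≤ B ∧ ∀ n, a n ≤ B ∧ (a n)⁻¹ ≤ B ∧ |b (n+1)| ≤ B := by
  have h1 : Summable (fun n : ℕ => |a (n+1) - 1|) :=
    hsum.of_nonneg_of_le (fun _ => abs_nonneg _) (fun n => by linarith [abs_nonneg (b (n+1))])
  have h2 : Summable (fun n : ℕ => |b (n+1)|) :=
    hsum.of_nonneg_of_le (fun _ => abs_nonneg _) (fun n => by linarith [abs_nonneg (a (n+1) - 1)])
  have h3 : Summable (fun n : ℕ => |a n - 1|) := (summable_nat_add_iff 1).1 h1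
  refine ⟨h3.add h2, ?_⟩
  have t1 : Filter.Tendsto a Filter.atTop (nhds 1) := by
    have := (summable_abs_iff.1 h3).tendsto_atTop_zero
    simpa using this.add_const 1
  have t2 : Filter.Tendsto (fun n => (a n)⁻¹) Filter.atTop (nhds 1) := by
    simpa using t1.inv₀ one_ne_zero
  have t3 := h2.tendsto_atTop_zero
  obtain ⟨B1, hB1⟩ := t1.bddAbove_range
  obtain ⟨B2, hB2⟩ := t2.bddAbove_range
  obtain ⟨B3, hB3⟩ := t3.bddAbove_range
  refine ⟨max 1 (max B1 (max B2 B3)), le_max_left _ _, fun n => ⟨?_, ?_, ?_⟩⟩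
  · have := hB1 ⟨n, rfl⟩; simp [this]
  · have := hB2 ⟨n, rfl⟩; simp only at this; simp [this]
  · have := hB3 ⟨n, rfl⟩; simp only at this; simp [this]

lemma cj_P_le (a b : ℕ → ℝ) (ha : ∀ n, 0 < a n) (B s : ℝ) (hs : 0 < s)
    (hB1 : 1 ≤ B) (hB : ∀ n, a n ≤ B ∧ (a n)⁻¹ ≤ B ∧ |b (n+1)| ≤ B) (n : ℕ) (t : ℝ)
    (ht : s ≤ Real.sin t) :
    |orthoPAux a b (n+1) (2 * Real.cos t)| + |orthoPAux a b n (2 * Real.cos t)|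
      ≤ (1 / s + B * (1 + (1 + B) / s)) * ‖cjg a b n t‖ ∧
    |orthoPAux a b (n+1) (2 * Real.cos t)| + |orthoPAux a b n (2 * Real.cos t)|
      ≤ (1 / s + B * (1 + (1 + B) / s)) * ‖cjg a b (n+1) t‖ := by
  have him : ∀ k, |orthoPAux a b k (2 * Real.cos t)| ≤ ‖cjg a b k t‖ / s := by
    intro k
    rw [le_div_iff₀ hs]
    have := Complex.abs_im_le_norm (cjg a b k t)
    rw [cjg_im, abs_mul, abs_of_pos (hs.trans_le ht)] at this
    have h0 := abs_nonneg (orthoPAux a b k (2 * Real.cos t))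
    nlinarith
  have hinv : ∀ y z : ℝ, |a n * y| ≤ z → |y| ≤ B * z := by
    intro y z h
    rw [abs_mul, abs_of_pos (ha n)] at h
    have hz : 0 ≤ z := le_trans (mul_nonneg (ha n).le (abs_nonneg y)) h
    calc |y| = (a n)⁻¹ * (a n * |y|) := by field_simp [(ha n).ne']
      _ ≤ B * z := by
        have := (hB n).2.1
        have := (ha n).le
        gcongr
  set P := orthoPAux a b (n+1) (2 * Real.cos t) with hP
  set Q := orthoPAux a b n (2 * Real.cos t) with hQ
  have hP1 := him (n+1)
  have hQ1 := him n
  rw [← hP] at hP1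
  rw [← hQ] at hQ1
  constructor
  · have : |P| ≤ B * (‖cjg a b n t‖ + ‖cjg a b n t‖ / s) := by
      apply hinv
      have e : ((a n * P : ℝ) : ℂ) = cjg a b n t + Complex.exp (((-t : ℝ)) * Complex.I) * (Q : ℝ) := by
        rw [cjg]; ring
      rw [← Real.norm_eq_abs, ← Complex.norm_real, e]
      refine (norm_add_le _ _).trans ?_
      rw [norm_mul, Complex.norm_exp_ofReal_mul_I, one_mul, Complex.norm_real, Real.norm_eq_abs]
      linarith
    have h2 : 0 ≤ B * (B * (‖cjg a b n t‖ / s)) := by positivity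
    have e : (1 / s + B * (1 + (1 + B) / s)) * ‖cjg a b n t‖ =
      ‖cjg a b n t‖ / s + B * (‖cjg a b n t‖ + ‖cjg a b n t‖ / s) + B * (B * (‖cjg a b n t‖ / s)) := by
      field_simp; ring
    linarith
  · have : |Q| ≤ B * (‖cjg a b (n+1) t‖ + (1 + B) * (‖cjg a b (n+1) t‖ / s)) := by
      apply hinv
      have e : ((a n * Q : ℝ) : ℂ) = (Complex.exp ((t : ℝ) * Complex.I) - (b (n+1) : ℝ)) * (P : ℝ) - cjg a b (n+1) t := by
        rw [cjg_succ a b ha]; push_cast; ring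
      rw [← Real.norm_eq_abs, ← Complex.norm_real, e]
      refine (norm_sub_le _ _).trans ?_
      rw [norm_mul, Complex.norm_real, Real.norm_eq_abs]
      have h1 : ‖Complex.exp ((t : ℝ) * Complex.I) - (b (n+1) : ℝ)‖ ≤ 1 + B := by
        refine (norm_sub_le _ _).trans ?_
        rw [Complex.norm_exp_ofReal_mul_I, Complex.norm_real, Real.norm_eq_abs]
        linarith [(hB n).2.2]
      have h2 : ‖Complex.exp ((t : ℝ) * Complex.I) - (b (n+1) : ℝ)‖ * |P| ≤ (1 + B) * (‖cjg a b (n+1) t‖ / s) := by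
        gcongr
      linarith
    have e : (1 / s + B * (1 + (1 + B) / s)) * ‖cjg a b (n+1) t‖ =
      ‖cjg a b (n+1) t‖ / s + B * (‖cjg a b (n+1) t‖ + (1 + B) * (‖cjg a b (n+1) t‖ / s)) := by
      field_simp
    linarith

/-- All uniform bounds. -/
lemma cj_unif (a b : ℕ → ℝ) (ha : ∀ n, 0 < a n) (ha0 : a 0 = 1)
    (hsum : Summable (fun n : ℕ => |a (n+1) - 1| + |b (n+1)|)) (s : ℝ) (hs : 0 < s) :
    ∃ c C : ℝ, 0 < c ∧ 0 < C ∧ (∀ n t, s ≤ Real.sin t → c ≤ ‖cjG a b n t‖ ∧ ‖cjG a b n t‖ ≤ C) ∧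
      ∀ η > 0, ∃ M, ∀ n ≥ M, ∀ t, s ≤ Real.sin t → ‖cjG a b n t - cjG a b M t‖ < η := by
  obtain ⟨hse, B, hB1, hB⟩ := cj_bdd a b ha hsum
  set e : ℕ → ℝ := fun n => |a n - 1| + |b (n+1)| with he
  have he0 : ∀ n, 0 ≤ e n := fun n => by positivity
  set K := 1 / s + B * (1 + (1 + B) / s) with hK
  have hK0 : 0 < K := by positivity
  set L := ∑' n, e n
  have hSL : ∀ n, ∑ k ∈ Finset.range n, e k ≤ L := fun n => hse.sum_le_tsum _ (fun i _ => he0 i)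
  have hL0 : 0 ≤ L := by simpa using hSL 0
  have hexp : ∀ t n, ‖Complex.exp ((t : ℝ) * Complex.I) * cjg a b n t‖ = ‖cjg a b n t‖ := by
    intro t n; rw [norm_mul, Complex.norm_exp_ofReal_mul_I, one_mul]
  have up : ∀ n t, s ≤ Real.sin t → ‖cjg a b n t‖ ≤ Real.exp (K * ∑ k ∈ Finset.range n, e k) := by
    intro n t ht
    induction n with
    | zero => simp [cjg_zero a b ha0]
    | succ n ih =>
      have h1 := cjg_step a b ha n t
      have h2 := (cj_P_le a b ha B s hs hB1 hB n t ht).1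
      have h3 := norm_sub_norm_le (cjg a b (n+1) t) (Complex.exp ((t : ℝ) * Complex.I) * cjg a b n t)
      rw [hexp] at h3
      have h4 := mul_le_mul_of_nonneg_left h2 (he0 n)
      have h5 := Real.add_one_le_exp (K * e n)
      rw [Finset.sum_range_succ, mul_add, Real.exp_add, mul_comm]
      calc ‖cjg a b (n+1) t‖ ≤ (K * e n + 1) * ‖cjg a b n t‖ := by
            simp only [he] at h4 ⊢; linarith
        _ ≤ _ := by gcongr
  have low : ∀ n t, s ≤ Real.sin t → 1 ≤ Real.exp (K * ∑ k ∈ Finset.range n, e k) * ‖cjg a b n t‖ := by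
    intro n t ht
    induction n with
    | zero => simp [cjg_zero a b ha0]
    | succ n ih =>
      have h1 := cjg_step a b ha n t
      have h2 := (cj_P_le a b ha B s hs hB1 hB n t ht).2
      have h3 := norm_sub_norm_le (Complex.exp ((t : ℝ) * Complex.I) * cjg a b n t) (cjg a b (n+1) t)
      rw [hexp, norm_sub_rev] at h3
      have h4 := mul_le_mul_of_nonneg_left h2 (he0 n)
      have h5 := Real.add_one_le_exp (K * e n)
      rw [Finset.sum_range_succ, mul_add, Real.exp_add, mul_assoc]
      refine ih.trans ?_
      gcongr
      calc ‖cjg a b n t‖ ≤ (K * e n + 1) * ‖cjg a b (n+1) t‖ := by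
            simp only [he] at h4 ⊢; linarith
        _ ≤ _ := by gcongr
  have step : ∀ n t, s ≤ Real.sin t → ‖cjG a b (n+1) t - cjG a b n t‖ ≤ K * Real.exp (K * L) * e n := by
    intro n t ht
    have e1 : cjG a b (n+1) t - cjG a b n t = Complex.exp ((-((n+1 : ℕ) * t) : ℝ) * Complex.I) *
        (cjg a b (n+1) t - Complex.exp ((t : ℝ) * Complex.I) * cjg a b n t) := by
      rw [cjG, cjG, mul_sub, ← mul_assoc, ← Complex.exp_add]
      congr 3
      push_cast; ring_nf
    rw [e1, norm_mul, Complex.norm_exp_ofReal_mul_I, one_mul]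
    have h1 := cjg_step a b ha n t
    have h2 := (cj_P_le a b ha B s hs hB1 hB n t ht).1
    have h3 : ‖cjg a b n t‖ ≤ Real.exp (K * L) := (up n t ht).trans (by
      have := hSL n
      gcongr)
    calc _ ≤ e n * (K * Real.exp (K * L)) := h1.trans (by
            refine mul_le_mul_of_nonneg_left (h2.trans ?_) (he0 n)
            gcongr)
      _ = _ := by ring
  refine ⟨Real.exp (-(K * L)), Real.exp (K * L), Real.exp_pos _, Real.exp_pos _, ?_, ?_⟩
  · intro n t ht
    rw [cjG_norm]
    have hm : Real.exp (K * ∑ k ∈ Finset.range n, e k) ≤ Real.exp (K * L) := by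
      have := hSL n
      gcongr
    refine ⟨?_, (up n t ht).trans hm⟩
    rw [Real.exp_neg, inv_le_iff_one_le_mul₀' (Real.exp_pos _)]
    exact (low n t ht).trans (by gcongr)
  · intro η hη
    set D := K * Real.exp (K * L) with hD
    have hD0 : 0 < D := by positivity
    have tail : ∀ M n, M ≤ n → ∀ t, s ≤ Real.sin t →
        ‖cjG a b n t - cjG a b M t‖ ≤ D * (∑ k ∈ Finset.range n, e k - ∑ k ∈ Finset.range M, e k) := by
      intro M n hn t ht
      induction n, hn using Nat.le_induction with
      | base => simp
      | succ n hn ih =>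
        have h1 := step n t ht
        rw [Finset.sum_range_succ]
        have h2 := norm_add_le (cjG a b (n+1) t - cjG a b n t) (cjG a b n t - cjG a b M t)
        rw [sub_add_sub_cancel] at h2
        linarith
    have hlim := hse.hasSum.tendsto_sum_nat
    have hev : ∀ᶠ M in Filter.atTop, L - η / D < ∑ k ∈ Finset.range M, e k :=
      hlim.eventually_const_lt (by have : 0 < η / D := by positivity
                                   linarith)
    obtain ⟨M, hM⟩ := hev.exists
    refine ⟨M, fun n hn t ht => (tail M n hn t ht).trans_lt ?_⟩
    have := hSL n
    calc D * (∑ k ∈ Finset.range n, e k - ∑ k ∈ Finset.range M, e k) < D * (η / D) := by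
          gcongr; linarith
      _ = η := by field_simp

/-- Uniform equicontinuity. -/
lemma cj_equi (a b : ℕ → ℝ) (ha : ∀ n, 0 < a n) (ha0 : a 0 = 1)
    (hsum : Summable (fun n : ℕ => |a (n+1) - 1| + |b (n+1)|)) (s : ℝ) (hs : 0 < s)
    (α β : ℝ) (hαβ : ∀ t ∈ Set.Icc α β, s ≤ Real.sin t) (κ : ℝ) (hκ : 0 < κ) :
    ∃ δ > 0, ∀ n, ∀ t ∈ Set.Icc α β, ∀ u ∈ Set.Icc α β, |u - t| < δ →
      ‖cjG a b n u - cjG a b n t‖ ≤ κ := by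
  obtain ⟨c, C, hc, hC, hb, hcau⟩ := cj_unif a b ha ha0 hsum s hs
  have single : ∀ n, ∀ η > 0, ∃ δ > 0, ∀ t ∈ Set.Icc α β, ∀ u ∈ Set.Icc α β, |u - t| < δ →
      ‖cjG a b n u - cjG a b n t‖ < η := by
    intro n η hη
    have huc := isCompact_Icc.uniformContinuousOn_of_continuous
      (cjG_cont a b n).continuousOn (s := Set.Icc α β)
    rw [Metric.uniformContinuousOn_iff] at huc
    obtain ⟨δ, hδ, h⟩ := huc η hη
    refine ⟨δ, hδ, fun t ht u hu htu => ?_⟩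
    have := h u hu t ht (by rwa [Real.dist_eq])
    rwa [dist_eq_norm] at this
  have fin : ∀ M : ℕ, ∀ η > 0, ∃ δ > 0, ∀ n ≤ M, ∀ t ∈ Set.Icc α β, ∀ u ∈ Set.Icc α β, |u - t| < δ →
      ‖cjG a b n u - cjG a b n t‖ < η := by
    intro M η hη
    induction M with
    | zero =>
      obtain ⟨δ, hδ, h⟩ := single 0 η hη
      exact ⟨δ, hδ, fun n hn => by obtain rfl : n = 0 := by omega
                                   exact h⟩
    | succ M ih =>
      obtain ⟨δ, hδ, h⟩ := single (M+1) η hη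
      obtain ⟨δ', hδ', h'⟩ := ih
      refine ⟨min δ δ', lt_min hδ hδ', fun n hn t ht u hu htu => ?_⟩
      rcases Nat.lt_or_ge M n with h1 | h1
      · obtain rfl : n = M + 1 := by omega
        exact h t ht u hu (htu.trans_le (min_le_left _ _))
      · exact h' n h1 t ht u hu (htu.trans_le (min_le_right _ _))
  obtain ⟨M, hM⟩ := hcau (κ / 3) (by positivity)
  obtain ⟨δ, hδ, h⟩ := fin M (κ / 3) (by positivity)
  refine ⟨δ, hδ, fun n t ht u hu htu => ?_⟩
  rcases le_total n M with h1 | h1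
  · have := h n h1 t ht u hu htu
    linarith
  · have h2 := hM n h1 t (hαβ t ht)
    have h3 := hM n h1 u (hαβ u hu)
    have h4 := h M le_rfl t ht u hu htu
    have e : cjG a b n u - cjG a b n t = (cjG a b n u - cjG a b M u) + (cjG a b M u - cjG a b M t)
      - (cjG a b n t - cjG a b M t) := by ring
    rw [e]
    have h5 := norm_sub_le ((cjG a b n u - cjG a b M u) + (cjG a b M u - cjG a b M t)) (cjG a b n t - cjG a b M t)
    have h6 := norm_add_le (cjG a b n u - cjG a b M u) (cjG a b M u - cjG a b M t)
    linarith

lemma cj_sum_low (a b : ℕ → ℝ) (B c : ℝ) (hB1 : 1 ≤ B) (hc : 0 < c)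
    (ha : ∀ n, 0 < a n) (hB : ∀ n, a n ≤ B) (t : ℝ) (hlow : ∀ n, c ≤ ‖cjg a b n t‖) (n : ℕ) :
    c ^ 2 / (2 * B ^ 2) * n + orthoPAux a b n (2 * Real.cos t) ^ 2 ≤
      2 * ∑ k ∈ Finset.range (n+1), orthoPAux a b k (2 * Real.cos t) ^ 2 := by
  have key : ∀ k, c ^ 2 / (2 * B ^ 2) ≤ orthoPAux a b k (2 * Real.cos t) ^ 2
      + orthoPAux a b (k+1) (2 * Real.cos t) ^ 2 := by
    intro k
    have h1 := hlow k
    rw [cjg] at h1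
    have h2 := h1.trans (norm_sub_le _ _)
    rw [norm_mul, Complex.norm_exp_ofReal_mul_I, one_mul, Complex.norm_real, Complex.norm_real,
      Real.norm_eq_abs, Real.norm_eq_abs, abs_mul, abs_of_pos (ha k)] at h2
    set P := orthoPAux a b (k+1) (2 * Real.cos t)
    set Q := orthoPAux a b k (2 * Real.cos t)
    have h3 : c ≤ B * (|P| + |Q|) := by
      have := mul_le_mul_of_nonneg_right (hB k) (abs_nonneg P)
      have := mul_le_mul_of_nonneg_right hB1 (abs_nonneg Q)
      linarith
    have h4 : c ^ 2 ≤ (B * (|P| + |Q|)) ^ 2 := by gcongr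
    rw [div_le_iff₀ (by positivity), ← sq_abs P, ← sq_abs Q]
    have h5 : (|P| + |Q|) ^ 2 ≤ 2 * (|P| ^ 2 + |Q| ^ 2) := by nlinarith [sq_nonneg (|P| - |Q|)]
    have h6 := mul_le_mul_of_nonneg_left h5 (sq_nonneg B)
    nlinarith
  induction n with
  | zero => simp [orthoPAux]
  | succ n ih =>
    rw [Finset.sum_range_succ]
    have := key n
    push_cast
    linarith

set_option maxHeartbeats 1600000 in
lemma cj_gap (a b : ℕ → ℝ) (ha : ∀ n, 0 < a n) (ha0 : a 0 = 1)
    (hsum : Summable (fun n : ℕ => |a (n+1) - 1| + |b (n+1)|)) (s : ℝ) (hs : 0 < s)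
    (α β : ℝ) (hα : 0 ≤ α) (hβ : β ≤ Real.pi)
    (hαβ : ∀ t ∈ Set.Icc α β, s ≤ Real.sin t) (η : ℝ) (hη : 0 < η) (hη1 : η ≤ 1) :
    ∃ N : ℕ, ∀ n ≥ N, ∀ t ∈ Set.Icc α β, ∀ u ∈ Set.Icc α β, t < u →
      orthoPAux a b (n+1) (2 * Real.cos t) = 0 → orthoPAux a b (n+1) (2 * Real.cos u) = 0 →
      (∀ v ∈ Set.Ioo t u, orthoPAux a b (n+1) (2 * Real.cos v) ≠ 0) →
      |((n+1 : ℕ) : ℝ) * (u - t) - Real.pi| ≤ η := by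
  obtain ⟨-, B, hB1, hB⟩ := cj_bdd a b ha hsum
  obtain ⟨c, C, hc, hC, hb, -⟩ := cj_unif a b ha ha0 hsum s hs
  have hpi := Real.pi_gt_three
  have hpi4 := Real.pi_le_four
  set c1 := c ^ 2 / (2 * B ^ 2) with hc1
  have hc1p : 0 < c1 := by positivity
  set σ := s ^ 2 * c1 / 2 with hσ
  have hσp : 0 < σ := by positivity
  set τ := min η (σ / (8 * C ^ 2)) with hτ
  have hτ0 : 0 < τ := lt_min hη (by positivity)
  have hτη : τ ≤ η := min_le_left _ _
  have hτσ : τ * (8 * C ^ 2) ≤ σ := by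
    rw [← le_div_iff₀ (by positivity)]; exact min_le_right _ _
  have hs1 : 0 < Real.sin τ := Real.sin_pos_of_pos_of_lt_pi hτ0 (by linarith)
  have hs2 : 0 < Real.sin (η / 2) := Real.sin_pos_of_pos_of_lt_pi (by linarith) (by linarith)
  set κ := min (c * Real.sin τ / 2) (min (c * Real.sin (η / 2) / 2) (σ / (8 * C))) with hκ
  have p1 : 0 < c * Real.sin τ := by positivity
  have p2 : 0 < c * Real.sin (η / 2) := by positivity
  have hκ0 : 0 < κ := lt_min (by positivity) (lt_min (by positivity) (by positivity))
  have hκ1 : κ < c * Real.sin τ := (min_le_left _ _).trans_lt (by linarith)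
  have hκ2 : κ < c * Real.sin (η / 2) :=
    ((min_le_right _ _).trans (min_le_left _ _)).trans_lt (by linarith)
  have hκ3 : κ * (8 * C) ≤ σ := by
    rw [← le_div_iff₀ (by positivity)]; exact (min_le_right _ _).trans (min_le_right _ _)
  obtain ⟨δ, hδ, heq⟩ := cj_equi a b ha ha0 hsum s hs α β hαβ κ hκ0
  obtain ⟨N, hN⟩ := exists_nat_gt (5 / δ)
  refine ⟨N + 1, fun n hn t ht u hu htu hzt hzu hno => ?_⟩
  set m := n + 1 with hm
  have hmR : (0:ℝ) < (m:ℕ) := by exact_mod_cast Nat.succ_pos n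
  have hmδ : 5 / (m:ℝ) < δ := by
    rw [div_lt_iff₀ hmR]
    rw [div_lt_iff₀ hδ] at hN
    have : (N:ℝ) ≤ m := by exact_mod_cast (by omega)
    nlinarith
  have hsin : ∀ v, t ≤ v → v ≤ u → s ≤ Real.sin v := fun v h1 h2 =>
    hαβ v ⟨ht.1.trans h1, h2.trans hu.2⟩
  have hF : ∀ (k : ℕ) (v : ℝ), (Complex.exp ((k * v : ℝ) * Complex.I) * cjG a b k v).im
      = Real.sin v * orthoPAux a b k (2 * Real.cos v) := fun k v => by rw [cjG_mul, cjg_im]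
  have hup : (m:ℝ) * (u - t) < Real.pi + η := by
    refine cj_upper (cjG a b m) (cjG_cont a b m) m (Nat.succ_pos n) t u κ c η hη hη1
      (hb m t (hαβ t ht)).1 hκ2 ?_ ?_ ?_
    · rw [hF, hzt, mul_zero]
    · intro v hv hvu
      refine heq m t ht v ⟨ht.1.trans hv.1, hvu.trans hu.2⟩ ?_
      rw [abs_of_nonneg (by linarith [hv.1])]
      refine lt_of_le_of_lt ?_ hmδ
      have h1 : (Real.pi + η) / (m:ℝ) ≤ 5 / m := by gcongr; linarith
      linarith [hv.2]
    · intro v hv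
      rw [hF]
      exact mul_ne_zero (hs.trans_le (hsin v hv.1.le hv.2.le)).ne' (hno v hv)
  have hut : |u - t| < δ := by
    rw [abs_of_pos (by linarith)]
    refine lt_of_le_of_lt ?_ hmδ
    rw [le_div_iff₀ hmR]; linarith
  rcases cj_dich (cjG a b m) m t u κ c τ hτ0 (by linarith) (hb m t (hαβ t ht)).1 hκ1
    (by rw [hF, hzt, mul_zero]) (by rw [hF, hzu, mul_zero]) (heq m t ht u hu hut) with h | h
  · exfalso
    have hcos : Real.cos u < Real.cos t :=
      Real.cos_lt_cos_of_nonneg_of_le_pi (hα.trans ht.1) (hu.2.trans hβ) htu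
    have hCD := cj_CD a b ha (2 * Real.cos t) (2 * Real.cos u) n
    rw [← hm, hzt, hzu] at hCD
    have hsum0 : ∑ k ∈ Finset.range m, orthoPAux a b k (2 * Real.cos t) * orthoPAux a b k (2 * Real.cos u) = 0 := by
      have h1 : (2 * Real.cos t - 2 * Real.cos u) ≠ 0 := by
        have : 0 < 2 * Real.cos t - 2 * Real.cos u := by linarith
        exact this.ne'
      have h2 : (2 * Real.cos t - 2 * Real.cos u) * ∑ k ∈ Finset.range m, orthoPAux a b k (2 * Real.cos t) * orthoPAux a b k (2 * Real.cos u) = 0 := by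
        rw [hCD]; ring
      exact (mul_eq_zero.1 h2).resolve_left h1
    have hlow := cj_sum_low a b B c hB1 hc ha (fun n => (hB n).1) t
      (fun k => by rw [← cjG_norm]; exact (hb k t (hαβ t ht)).1) n
    have hterm : ∀ k ∈ Finset.range m,
        Real.sin t ^ 2 * orthoPAux a b k (2 * Real.cos t) ^ 2 - C * (τ * C + κ) ≤
        Real.sin t * Real.sin u * (orthoPAux a b k (2 * Real.cos t) * orthoPAux a b k (2 * Real.cos u)) := by
      intro k hk
      have h1 := cj_small (cjG a b k) k m (Finset.mem_range.1 hk).le t u κ C τ htu.le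
        (hb k t (hαβ t ht)).2 h.le (heq k t ht u hu hut)
      rw [hF, hF] at h1
      have h2 : |Real.sin t * orthoPAux a b k (2 * Real.cos t)| ≤ C := by
        rw [← cjg_im]
        refine (Complex.abs_im_le_norm _).trans ?_
        rw [← cjG_norm]; exact (hb k t (hαβ t ht)).2
      set X := Real.sin t * orthoPAux a b k (2 * Real.cos t)
      set Y := Real.sin u * orthoPAux a b k (2 * Real.cos u)
      have h3 : |X * (Y - X)| ≤ C * (τ * C + κ) := by
        rw [abs_mul]; gcongr
      have h4 := (abs_le.1 h3).1
      have e1 : Real.sin t ^ 2 * orthoPAux a b k (2 * Real.cos t) ^ 2 = X ^ 2 := by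
        simp only [X]; ring
      have e2 : Real.sin t * Real.sin u * (orthoPAux a b k (2 * Real.cos t) * orthoPAux a b k (2 * Real.cos u)) = X * Y := by
        simp only [X, Y]; ring
      rw [e1, e2]
      linarith
    have hS := Finset.sum_le_sum hterm
    rw [← Finset.mul_sum, hsum0, mul_zero, Finset.sum_sub_distrib, ← Finset.mul_sum,
      Finset.sum_const, Finset.card_range, nsmul_eq_mul] at hS
    have hst : s ^ 2 ≤ Real.sin t ^ 2 := by
      have := hαβ t ht
      gcongr
    set S := ∑ k ∈ Finset.range m, orthoPAux a b k (2 * Real.cos t) ^ 2 with hSdef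
    have hS1 : c1 * n ≤ 2 * S := by
      have := sq_nonneg (orthoPAux a b n (2 * Real.cos t))
      linarith
    have hS0 : 0 ≤ S := Finset.sum_nonneg (fun _ _ => sq_nonneg _)
    have hn1 : (1:ℝ) ≤ n := by exact_mod_cast (by omega : 1 ≤ n)
    have hmn : (m:ℝ) ≤ 2 * n := by rw [hm]; push_cast; linarith
    have h1 : σ * n ≤ Real.sin t ^ 2 * S := by
      calc σ * n = s ^ 2 * (c1 * n / 2) := by rw [hσ]; ring
        _ ≤ s ^ 2 * S := by gcongr; linarith
        _ ≤ _ := by gcongr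
    have h2 : C * (τ * C + κ) ≤ σ / 4 := by nlinarith
    have h3 : (m:ℝ) * (C * (τ * C + κ)) ≤ 2 * n * (σ / 4) := mul_le_mul hmn h2 (by positivity) (by positivity)
    have h4 : 0 < σ * n := mul_pos hσp (by linarith)
    linarith
  · rw [abs_le]; constructor <;> linarith

lemma cj_cos_diff (u d : ℝ) (hd : 0 < d) (hd1 : d ≤ 1) :
    |Real.cos (u - d) - Real.cos u - d * Real.sin u| ≤ d ^ 2 := by
  have h1 := Real.sin_gt_sub_cube hd
  have h2 := Real.sin_lt hd
  have h3 := Real.one_sub_sq_div_two_le_cos (x := d)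
  have h4 := Real.cos_le_one d
  have e : Real.cos (u - d) - Real.cos u - d * Real.sin u
      = Real.cos u * (Real.cos d - 1) + Real.sin u * (Real.sin d - d) := by
    rw [Real.cos_sub]; ring
  rw [e]
  refine (abs_add_le _ _).trans ?_
  rw [abs_mul, abs_mul]
  have a1 : |Real.cos d - 1| ≤ d ^ 2 / 2 := by rw [abs_le]; constructor <;> nlinarith
  have a2 : |Real.sin d - d| ≤ d ^ 2 / 4 := by
    rw [abs_le]; constructor <;> nlinarith [mul_pos hd hd]
  have b1 := mul_le_mul (Real.abs_cos_le_one u) a1 (abs_nonneg _) zero_le_one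
  have b2 := mul_le_mul (Real.abs_sin_le_one u) a2 (abs_nonneg _) zero_le_one
  nlinarith

set_option maxHeartbeats 1600000 in
theorem stmt_4 (a b : ℕ → ℝ) (ha : ∀ n, 0 < a n) (ha0 : a 0 = 1)
    (hsum : Summable (fun n : ℕ => |a (n+1) - 1| + |b (n+1)|))
    (ε : ℝ) (hε : 0 < ε) (hε2 : ε < 2) :
    ∀ εp > (0:ℝ), ∃ N : ℕ, ∀ n ≥ N,
      ∀ E ∈ Set.Icc (-2 + ε) (2 - ε), ∀ E' ∈ Set.Icc (-2 + ε) (2 - ε),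
      E < E' → orthoP a b n E = 0 → orthoP a b n E' = 0 →
      (∀ x ∈ Set.Ioo E E', orthoP a b n x ≠ 0) →
      |(n : ℝ) * (E' - E) - Real.pi * Real.sqrt (4 - E ^ 2)| < εp := by
  intro εp hεp
  have hpi := Real.pi_gt_three
  have hpi4 := Real.pi_le_four
  set α := Real.arccos (1 - ε / 2) with hα
  set β := Real.arccos (-1 + ε / 2) with hβ
  have hα0 : 0 ≤ α := Real.arccos_nonneg _
  have hβ0 : β ≤ Real.pi := Real.arccos_le_pi _
  have hcα : Real.cos α = 1 - ε / 2 := Real.cos_arccos (by linarith) (by linarith)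
  have hcβ : Real.cos β = -1 + ε / 2 := Real.cos_arccos (by linarith) (by linarith)
  set s := ε - ε ^ 2 / 4 with hs
  have hs0 : 0 < s := by rw [hs]; nlinarith
  have hαβ : ∀ t ∈ Set.Icc α β, s ≤ Real.sin t := by
    intro t ht
    have h1 : Real.cos t ≤ 1 - ε / 2 := by
      rw [← hcα]; exact Real.cos_le_cos_of_nonneg_of_le_pi hα0 (ht.2.trans hβ0) ht.1
    have h2 : -1 + ε / 2 ≤ Real.cos t := by
      rw [← hcβ]; exact Real.cos_le_cos_of_nonneg_of_le_pi (hα0.trans ht.1) hβ0 ht.2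
    have h3 : 0 ≤ Real.sin t := Real.sin_nonneg_of_nonneg_of_le_pi (hα0.trans ht.1) (ht.2.trans hβ0)
    have h4 := Real.sin_le_one t
    have h5 := Real.sin_sq_add_cos_sq t
    rw [hs]; nlinarith
  obtain ⟨N, hN⟩ := cj_gap a b ha ha0 hsum s hs0 α β hα0 hβ0 hαβ (min 1 (εp / 8))
    (lt_min one_pos (by positivity)) (min_le_left _ _)
  obtain ⟨N', hN'⟩ := exists_nat_gt (max 5 (120 / εp))
  refine ⟨max N N', fun n hn E hE E' hE' hEE hz hz' hno => ?_⟩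
  have hnN : N ≤ n := (le_max_left _ _).trans hn
  have hnN' : (N':ℝ) ≤ n := by exact_mod_cast (le_max_right _ _).trans hn
  have hn5 : (5:ℝ) < n := (le_max_left _ _).trans_lt (hN'.trans_le hnN')
  have hnε : 120 / εp < (n:ℝ) := (le_max_right _ _).trans_lt (hN'.trans_le hnN')
  set u := Real.arccos (E / 2) with hu
  set t := Real.arccos (E' / 2) with ht
  have hcu : 2 * Real.cos u = E := by
    rw [hu, Real.cos_arccos (by linarith [hE.1]) (by linarith [hE.2])]; ring
  have hct : 2 * Real.cos t = E' := by
    rw [ht, Real.cos_arccos (by linarith [hE'.1]) (by linarith [hE'.2])]; ring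
  have htu : t < u := Real.arccos_lt_arccos (by linarith [hE.1]) (by linarith) (by linarith [hE'.2])
  have hmem : ∀ F ∈ Set.Icc (-2 + ε) (2 - ε), Real.arccos (F / 2) ∈ Set.Icc α β := by
    intro F hF
    exact ⟨Real.arccos_le_arccos (by linarith [hF.2]), Real.arccos_le_arccos (by linarith [hF.1])⟩
  have hum := hmem E hE
  have htm := hmem E' hE'
  rw [← hu] at hum
  rw [← ht] at htm
  have hgap := hN n hnN t htm u hum htu (by rw [hct]; exact hz') (by rw [hcu]; exact hz) (by
    intro v hv
    refine hno _ ⟨?_, ?_⟩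
    · rw [← hcu]
      have := Real.cos_lt_cos_of_nonneg_of_le_pi (hα0.trans (htm.1.trans hv.1.le)) (hum.2.trans hβ0) hv.2
      linarith
    · rw [← hct]
      have := Real.cos_lt_cos_of_nonneg_of_le_pi (hα0.trans htm.1) (hv.2.le.trans (hum.2.trans hβ0)) hv.1
      linarith)
  have hη1 : min 1 (εp / 8) ≤ 1 := min_le_left _ _
  have hη2 : min 1 (εp / 8) ≤ εp / 8 := min_le_right _ _
  set η := min 1 (εp / 8)
  set d := u - t with hd
  have hd0 : 0 < d := by rw [hd]; linarith
  push_cast at hgap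
  rw [abs_le] at hgap
  have hnd : (n:ℝ) * d ≤ 5 := by nlinarith
  have hd1 : d ≤ 1 := by nlinarith
  have hdε : 24 * d < εp := by
    rw [div_lt_iff₀ hεp] at hnε
    have : (n:ℝ) * (24 * d) < n * εp := by linarith
    exact lt_of_mul_lt_mul_left this (by positivity)
  have hcd := cj_cos_diff u d hd0 hd1
  have hut : u - d = t := by rw [hd]; ring
  rw [hut] at hcd
  have hsu : s ≤ Real.sin u := hαβ u hum
  have hsu1 := Real.sin_le_one u
  have hsqrt : Real.sqrt (4 - E ^ 2) = 2 * Real.sin u := by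
    rw [← hcu]
    have : 4 - (2 * Real.cos u) ^ 2 = (2 * Real.sin u) ^ 2 := by
      nlinarith [Real.sin_sq_add_cos_sq u]
    rw [this, Real.sqrt_sq (by linarith)]
  rw [hsqrt, ← hcu, ← hct]
  have e : (n:ℝ) * (2 * Real.cos t - 2 * Real.cos u) - Real.pi * (2 * Real.sin u)
      = 2 * n * (Real.cos t - Real.cos u - d * Real.sin u) + 2 * Real.sin u * (n * d - Real.pi) := by
    ring
  rw [e]
  refine (abs_add_le _ _).trans_lt ?_
  have b1 : |2 * n * (Real.cos t - Real.cos u - d * Real.sin u)| ≤ 10 * d := by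
    rw [abs_mul, abs_of_nonneg (by positivity)]
    calc 2 * (n:ℝ) * |Real.cos t - Real.cos u - d * Real.sin u| ≤ 2 * n * d ^ 2 := by gcongr
      _ = 2 * d * (n * d) := by ring
      _ ≤ 2 * d * 5 := by gcongr
      _ = _ := by ring
  have b2 : |2 * Real.sin u * (n * d - Real.pi)| ≤ 2 * (η + d) := by
    rw [abs_mul, abs_of_nonneg (by linarith)]
    have : |(n:ℝ) * d - Real.pi| ≤ η + d := by
      rw [abs_le]; constructor <;> linarith [hgap.1, hgap.2]
    have h0 : 0 ≤ η + d := (abs_nonneg _).trans this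
    calc 2 * Real.sin u * |(n:ℝ) * d - Real.pi| ≤ 2 * 1 * (η + d) :=
          mul_le_mul (by linarith) this (abs_nonneg _) (by norm_num)
      _ = _ := by ring
  linarith
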